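/- Let Q be a loop with two-sided inverses satisfying the WCIP, let σ be a permutation of Q, and let c ∈ Q. If σ is a left pseudoautomorphism of Q with companion c, then c⁻¹ is also a companion of σ (i.e., σ is a left pseudoautomorphism with companion c⁻¹) and c² lies in the left nucleus N_λ(Q). -/

import Mathlib

/-- A loop: a quasigroup (with left division `ldiv` and right division `rdiv`)
with a two-sided identity element. -/
class NLoop (Q : Type*) extends Mul Q, One Q where
  /-- left division: `ldiv a b = a \ b` -/
  ldiv : Q → Q → Q
  /-- right division: `rdiv b a = b / a` -/
  rdiv : Q → Q → Q
  mul_ldiv : ∀ a b : Q, a * ldiv a b = b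
  ldiv_mul : ∀ a b : Q, ldiv a (a * b) = b
  rdiv_mul : ∀ a b : Q, rdiv a b * b = a
  mul_rdiv : ∀ a b : Q, rdiv (a * b) b = a
  one_mul : ∀ a : Q, 1 * a = a
  mul_one : ∀ a : Q, a * 1 = a

/-- A loop with two-sided inverses. -/
class NInvLoop (Q : Type*) extends NLoop Q, Inv Q where
  mul_inv : ∀ a : Q, a * a⁻¹ = 1
  inv_mul : ∀ a : Q, a⁻¹ * a = 1

/-- `(α, β, γ)` is an autotopism: `xα · yβ = (x·y)γ`. -/
def IsAutotopism {Q : Type*} [NLoop Q] (α β γ : Q → Q) : Prop :=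
  ∀ x y : Q, α x * β y = γ (x * y)

/-- `σ` is an automorphism. -/
def IsAutomorphism {Q : Type*} [NLoop Q] (σ : Q → Q) : Prop :=
  ∀ x y : Q, σ (x * y) = σ x * σ y

/-- `β` is a left pseudoautomorphism with companion `a`. -/
def IsLeftPseudo {Q : Type*} [NLoop Q] (β : Q → Q) (a : Q) : Prop :=
  ∀ x y : Q, a * β (x * y) = (a * β x) * β y

/-- `γ` is a middle pseudoautomorphism with companion `c`. -/
def IsMiddlePseudo {Q : Type*} [NLoop Q] (γ : Q → Q) (c : Q) : Prop :=
  ∀ x y : Q, γ (x * y) = NLoop.rdiv (γ x) (NLoop.ldiv c 1) * NLoop.ldiv c (γ y)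

/-- `α` is a right pseudoautomorphism with companion `b`. -/
def IsRightPseudo {Q : Type*} [NLoop Q] (α : Q → Q) (b : Q) : Prop :=
  ∀ x y : Q, α (x * y) * b = α x * (α y * b)

theorem NInvLoop.inv_inv {Q : Type*} [NInvLoop Q] (a : Q) : a⁻¹⁻¹ = a := by
  rw [← NLoop.ldiv_mul a⁻¹ a⁻¹⁻¹, NInvLoop.mul_inv, ← NInvLoop.inv_mul a, NLoop.ldiv_mul]

theorem IsLeftPseudo.map_one {Q : Type*} [NLoop Q] {β : Q → Q} {a : Q}
    (h : IsLeftPseudo β a) : β 1 = 1 := by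
  have h1 := h 1 1
  rw [NLoop.one_mul] at h1
  rw [← NLoop.ldiv_mul (a * β 1) (β 1), ← h1]
  nth_rw 2 [← NLoop.mul_one (a * β 1)]
  rw [NLoop.ldiv_mul]

/-- In a loop with the WCIP, conjugating the outer components of an autotopism by inversion and
swapping them gives an autotopism. -/
theorem IsAutotopism.inv_conj {Q : Type*} [NInvLoop Q]
    (wcip : ∀ x y : Q, (x * y)⁻¹ * y = x⁻¹) {α β γ : Q → Q} (h : IsAutotopism α β γ) :
    IsAutotopism (fun u => (γ u⁻¹)⁻¹) β (fun u => (α u⁻¹)⁻¹) := by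
  intro u y
  obtain ⟨x, hx⟩ : ∃ x, x * y = u⁻¹ := ⟨_, NLoop.rdiv_mul u⁻¹ y⟩
  have hu : u * y = x⁻¹ := by
    rw [← NInvLoop.inv_inv u, ← hx, wcip]
  change (γ u⁻¹)⁻¹ * β y = (α (u * y)⁻¹)⁻¹
  rw [hu, NInvLoop.inv_inv, ← hx, ← h x y, wcip]

theorem IsLeftPseudo.inv_companion {Q : Type*} [NInvLoop Q]
    (wcip : ∀ x y : Q, (x * y)⁻¹ * y = x⁻¹) {σ : Q → Q} {c : Q} (h : IsLeftPseudo σ c) :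
    IsLeftPseudo σ c⁻¹ := by
  have hc : IsAutotopism (fun x => c * σ x) σ (fun x => c * σ x) := fun x y => (h x y).symm
  have hA : ∀ x y, (c * σ x⁻¹)⁻¹ * σ y = (c * σ (x * y)⁻¹)⁻¹ := hc.inv_conj wcip
  have inv_one : (1 : Q)⁻¹ = 1 := by
    rw [← NLoop.one_mul (1 : Q)⁻¹, NInvLoop.mul_inv]
  have hA1 : ∀ y, c⁻¹ * σ y = (c * σ y⁻¹)⁻¹ := fun y => by
    simpa only [inv_one, h.map_one, NLoop.mul_one, NLoop.one_mul] using hA 1 y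
  intro x y
  rw [hA1, hA1, hA]

/-- Two companions `a`, `b` of the same surjective left pseudoautomorphism differ by an element
of the left nucleus. -/
theorem IsLeftPseudo.mul_ldiv_one_mem_left_nucleus {Q : Type*} [NLoop Q] {σ : Q → Q} {a b : Q}
    (hσ : Function.Surjective σ) (ha : IsLeftPseudo σ a) (hb : IsLeftPseudo σ b) (x y : Q) :
    ((a * NLoop.ldiv b 1) * x) * y = (a * NLoop.ldiv b 1) * (x * y) := by
  have hF : ∀ x y, a * NLoop.ldiv b (x * y) = (a * NLoop.ldiv b x) * y := by
    intro x y
    obtain ⟨p, hp⟩ := hσ (NLoop.ldiv b x)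
    obtain ⟨q, rfl⟩ := hσ y
    have hx : x = b * σ p := by rw [hp, NLoop.mul_ldiv]
    rw [hx, ← hb, NLoop.ldiv_mul, NLoop.ldiv_mul, ha]
  rw [← hF, ← hF, ← hF, NLoop.one_mul, NLoop.one_mul]

/-- Theorem, part 2: In a WCIP loop with two-sided inverses, if a
permutation `σ` is a left pseudoautomorphism with companion `c`, then `c⁻¹` is
also a companion of `σ` and `c² ∈ N_λ(Q)`. -/
theorem stmt_15 (Q : Type*) [NInvLoop Q]
    (wcip : ∀ x y : Q, (x * y)⁻¹ * y = x⁻¹)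
    (σ : Equiv.Perm Q) (c : Q) (h : IsLeftPseudo (⇑σ) c) :
    IsLeftPseudo (⇑σ) c⁻¹ ∧ ∀ x y : Q, ((c * c) * x) * y = (c * c) * (x * y) := by
  have h' := h.inv_companion wcip
  have hc : NLoop.ldiv c⁻¹ 1 = c := by
    rw [← NInvLoop.inv_mul c, NLoop.ldiv_mul]
  refine ⟨h', fun x y => ?_⟩
  simpa only [hc] using h.mul_ldiv_one_mem_left_nucleus σ.surjective h' x y
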